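/- arXiv:2012.06355 — 4 statements merged into one kernel-verified Lean document; each statement's English description precedes it below -/
import Mathlib

section
/- Stieltjes–Perron inversion formula: let μ be a Borel probability measure on ℝ. Then (i) for all real numbers a < b, μ((a,b)) + (1/2)μ({a}) + (1/2)μ({b}) = −(1/π)·lim_{y↓0} ∫_a^b Im(G_μ(x+iy)) dx; (ii) for every a ∈ ℝ, μ({a}) = lim_{y↓0} (iy)·G_μ(a+iy); and consequently (iii) if μ, ν are Borel probability measures on ℝ with G_μ(z) = G_ν(z) for all z ∈ ℍ, then μ = ν. -/
open MeasureTheory Filter Topology Set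

/-- The Cauchy transform of a measure on ℝ, `G_μ(z) = ∫ 1/(z-x) dμ(x)`. -/
noncomputable def cauchyTransform (μ : Measure ℝ) (z : ℂ) : ℂ :=
  ∫ x, (z - (x : ℂ))⁻¹ ∂μ

theorem norm_resolvent_le {x y t : ℝ} (hy : 0 < y) :
    ‖((x : ℂ) + (y : ℂ) * Complex.I - (t : ℂ))⁻¹‖ ≤ y⁻¹ := by
  rw [norm_inv]
  apply inv_anti₀ hy
  simpa [abs_of_pos hy] using Complex.abs_im_le_norm ((x : ℂ) + (y : ℂ) * Complex.I - (t : ℂ))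

theorem im_resolvent (x y t : ℝ) :
    ((x : ℂ) + (y : ℂ) * Complex.I - (t : ℂ))⁻¹.im = -(y / ((x - t) ^ 2 + y ^ 2)) := by
  rw [Complex.inv_im]
  simp [Complex.normSq_apply, sq, neg_div]

theorem resolvent_denom_ne_zero {y : ℝ} (hy : 0 < y) (x t : ℝ) :
    (x : ℂ) + (y : ℂ) * Complex.I - (t : ℂ) ≠ 0 := by
  intro h
  simpa [hy.ne'] using congrArg Complex.im h

theorem continuous_resolvent {y : ℝ} (hy : 0 < y) :
    Continuous fun p : ℝ × ℝ => ((p.1 : ℂ) + (y : ℂ) * Complex.I - (p.2 : ℂ))⁻¹ :=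
  Continuous.inv₀ (by fun_prop) fun p => resolvent_denom_ne_zero hy p.1 p.2

theorem integrable_resolvent (μ : Measure ℝ) [IsFiniteMeasure μ] {y : ℝ} (hy : 0 < y) (x : ℝ) :
    Integrable (fun t : ℝ => ((x : ℂ) + (y : ℂ) * Complex.I - (t : ℂ))⁻¹) μ :=
  Integrable.of_bound
    ((continuous_resolvent hy).comp (Continuous.prodMk_right x)).aestronglyMeasurable y⁻¹
    (ae_of_all _ fun _ => norm_resolvent_le hy)

theorem intervalIntegral_poisson_kernel {y : ℝ} (hy : 0 < y) (a b t : ℝ) :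
    ∫ x in a..b, y / ((x - t) ^ 2 + y ^ 2)
      = Real.arctan ((b - t) / y) - Real.arctan ((a - t) / y) := by
  have hpos : ∀ x : ℝ, 0 < (x - t) ^ 2 + y ^ 2 := fun x => by positivity
  refine intervalIntegral.integral_eq_sub_of_hasDerivAt
    (f := fun x => Real.arctan ((x - t) / y)) (fun x _ => ?_)
    (Continuous.intervalIntegrable
      (continuous_const.div (by fun_prop) fun x => (hpos x).ne') _ _)
  have h := (((hasDerivAt_id x).sub_const t).div_const y).arctan
  refine h.congr_deriv ?_
  have := hpos x
  simp only [id]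
  field_simp
  ring

/-- Fubini for the imaginary part of the Cauchy transform. -/
theorem intervalIntegral_im_cauchyTransform (μ : Measure ℝ) [IsFiniteMeasure μ] {y : ℝ}
    (hy : 0 < y) (a b : ℝ) :
    ∫ x in a..b, (cauchyTransform μ ((x : ℂ) + (y : ℂ) * Complex.I)).im
      = -∫ t, (Real.arctan ((b - t) / y) - Real.arctan ((a - t) / y)) ∂μ := by
  have him : ∀ x : ℝ, (cauchyTransform μ ((x : ℂ) + (y : ℂ) * Complex.I)).im
      = ∫ t, ((x : ℂ) + (y : ℂ) * Complex.I - (t : ℂ))⁻¹.im ∂μ := fun x =>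
    (integral_im (𝕜 := ℂ) (integrable_resolvent μ hy x)).symm
  simp_rw [him]
  rw [intervalIntegral_integral_swap, ← integral_neg]
  · refine integral_congr_ae (ae_of_all _ fun t => ?_)
    simp only [im_resolvent]
    rw [intervalIntegral.integral_neg, intervalIntegral_poisson_kernel hy]
  · have : IsFiniteMeasure (volume.restrict (uIoc a b)) := ⟨by simp [uIoc]⟩
    refine Integrable.of_bound
      (Complex.continuous_im.comp (continuous_resolvent hy)).aestronglyMeasurable y⁻¹
      (ae_of_all _ fun p => ?_)
    exact (Complex.abs_im_le_norm _).trans (norm_resolvent_le hy)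

theorem tendsto_arctan_div_nhdsGT_zero (c : ℝ) :
    Tendsto (fun y : ℝ => Real.arctan (c / y)) (𝓝[>] 0) (𝓝 (Real.pi / 2 * Real.sign c)) := by
  rcases lt_trichotomy c 0 with hc | rfl | hc
  · rw [Real.sign_of_neg hc, mul_neg_one]
    exact (Real.tendsto_arctan_atBot.mono_right nhdsWithin_le_nhds).comp
      (tendsto_inv_nhdsGT_zero.const_mul_atTop_of_neg hc)
  · simp
  · rw [Real.sign_of_pos hc, mul_one]
    exact (Real.tendsto_arctan_atTop.mono_right nhdsWithin_le_nhds).comp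
      (tendsto_inv_nhdsGT_zero.const_mul_atTop hc)

theorem half_sign_sub_sign {a b : ℝ} (hab : a < b) (t : ℝ) :
    1 / 2 * (Real.sign (b - t) - Real.sign (a - t))
      = (Ioo a b).indicator 1 t + 1 / 2 * ({a} : Set ℝ).indicator 1 t
        + 1 / 2 * ({b} : Set ℝ).indicator 1 t := by
  simp only [indicator_apply, mem_Ioo, mem_singleton_iff, Pi.one_apply, Real.sign]
  split_ifs <;> first | (exfalso; grind) | norm_num

theorem integral_half_sign_sub_sign (μ : Measure ℝ) [IsFiniteMeasure μ] {a b : ℝ} (hab : a < b) :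
    ∫ t, 1 / 2 * (Real.sign (b - t) - Real.sign (a - t)) ∂μ
      = (μ (Ioo a b)).toReal + 1 / 2 * (μ {a}).toReal + 1 / 2 * (μ {b}).toReal := by
  have hint : ∀ s : Set ℝ, MeasurableSet s → Integrable (s.indicator (1 : ℝ → ℝ)) μ := fun s hs =>
    (integrable_const (1 : ℝ)).indicator hs
  simp_rw [half_sign_sub_sign hab]
  rw [integral_add, integral_add, integral_const_mul, integral_const_mul,
    integral_indicator_one measurableSet_Ioo, integral_indicator_one (measurableSet_singleton a),
    integral_indicator_one (measurableSet_singleton b)]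
  · rfl
  · exact hint _ measurableSet_Ioo
  · exact (hint _ (measurableSet_singleton a)).const_mul _
  · exact (hint _ measurableSet_Ioo).add ((hint _ (measurableSet_singleton a)).const_mul _)
  · exact (hint _ (measurableSet_singleton b)).const_mul _

theorem tendsto_intervalIntegral_im_cauchyTransform (μ : Measure ℝ) [IsFiniteMeasure μ]
    {a b : ℝ} (hab : a < b) :
    Tendsto
      (fun y : ℝ => -(1 / Real.pi) *
        ∫ x in a..b, (cauchyTransform μ ((x : ℂ) + (y : ℂ) * Complex.I)).im)
      (𝓝[>] 0)
      (𝓝 ((μ (Ioo a b)).toReal + (1 / 2) * (μ {a}).toReal + (1 / 2) * (μ {b}).toReal)) := by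
  have hlim : Tendsto (fun y : ℝ => ∫ t, 1 / Real.pi *
      (Real.arctan ((b - t) / y) - Real.arctan ((a - t) / y)) ∂μ) (𝓝[>] 0)
      (𝓝 (∫ t, 1 / 2 * (Real.sign (b - t) - Real.sign (a - t)) ∂μ)) := by
    refine tendsto_integral_filter_of_dominated_convergence (fun _ => 1)
      (Eventually.of_forall fun y => by fun_prop)
      (Eventually.of_forall fun y => ae_of_all _ fun t => ?_) (integrable_const _)
      (ae_of_all _ fun t => ?_)
    · have h1 := Real.arctan_lt_pi_div_two ((b - t) / y)
      have h2 := Real.arctan_lt_pi_div_two ((a - t) / y)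
      have h3 := Real.neg_pi_div_two_lt_arctan ((b - t) / y)
      have h4 := Real.neg_pi_div_two_lt_arctan ((a - t) / y)
      rw [Real.norm_eq_abs, abs_mul, abs_of_pos (by positivity : 0 < 1 / Real.pi), one_div,
        inv_mul_le_iff₀ Real.pi_pos, mul_one, abs_le]
      constructor <;> linarith
    · convert ((tendsto_arctan_div_nhdsGT_zero (b - t)).sub
        (tendsto_arctan_div_nhdsGT_zero (a - t))).const_mul (1 / Real.pi) using 2
      have := Real.pi_ne_zero
      field_simp
  rw [integral_half_sign_sub_sign μ hab] at hlim
  refine hlim.congr' ?_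
  filter_upwards [self_mem_nhdsWithin] with y hy
  rw [intervalIntegral_im_cauchyTransform μ hy, integral_const_mul, neg_mul_neg]

theorem tendsto_mul_cauchyTransform (μ : Measure ℝ) [IsFiniteMeasure μ] (a : ℝ) :
    Tendsto
      (fun y : ℝ => ((y : ℂ) * Complex.I) * cauchyTransform μ ((a : ℂ) + (y : ℂ) * Complex.I))
      (𝓝[>] 0) (𝓝 ((μ {a}).toReal : ℂ)) := by
  have hlim : Tendsto (fun y : ℝ => ∫ t : ℝ, ((y : ℂ) * Complex.I) *
      ((a : ℂ) + (y : ℂ) * Complex.I - (t : ℂ))⁻¹ ∂μ) (𝓝[>] 0)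
      (𝓝 (∫ t, ({a} : Set ℝ).indicator (fun _ => (1 : ℂ)) t ∂μ)) := by
    refine tendsto_integral_filter_of_dominated_convergence (fun _ => 1) ?_ ?_
      (integrable_const _) (ae_of_all _ fun t => ?_)
    · filter_upwards [self_mem_nhdsWithin] with y hy
      exact (integrable_resolvent μ hy a).aestronglyMeasurable.const_mul _
    · filter_upwards [self_mem_nhdsWithin] with y (hy : 0 < y)
      refine ae_of_all _ fun t => ?_
      rw [norm_mul, norm_mul, Complex.norm_I, mul_one, Complex.norm_real, Real.norm_of_nonneg hy.le]
      exact (mul_le_mul_of_nonneg_left (norm_resolvent_le hy) hy.le).trans_eq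
        (mul_inv_cancel₀ hy.ne')
    · by_cases ht : t = a
      · subst ht
        refine tendsto_const_nhds.congr' ?_
        filter_upwards [self_mem_nhdsWithin] with y (hy : 0 < y)
        have : (y : ℂ) ≠ 0 := by exact_mod_cast hy.ne'
        simp only [mem_singleton_iff, indicator_of_mem, add_sub_cancel_left]
        rw [mul_inv_cancel₀ (mul_ne_zero this Complex.I_ne_zero)]
      · rw [indicator_of_notMem (by simpa using ht)]
        have hne : (a : ℂ) + ((0 : ℝ) : ℂ) * Complex.I - (t : ℂ) ≠ 0 := by
          simpa [sub_eq_zero, eq_comm] using ht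
        have hc : ContinuousAt (fun y : ℝ => ((y : ℂ) * Complex.I) *
            ((a : ℂ) + (y : ℂ) * Complex.I - (t : ℂ))⁻¹) 0 :=
          ContinuousAt.mul (by fun_prop) (ContinuousAt.inv₀ (by fun_prop) hne)
        simpa using hc.tendsto.mono_left (nhdsWithin_le_nhds (s := Ioi 0))
  rw [integral_indicator_const _ (measurableSet_singleton a)] at hlim
  simpa [cauchyTransform, integral_const_mul, Measure.real] using hlim

theorem measure_ext_of_cauchyTransform (μ ν : Measure ℝ) [IsFiniteMeasure μ] [IsFiniteMeasure ν]
    (h : ∀ z : ℂ, 0 < z.im → cauchyTransform μ z = cauchyTransform ν z) : μ = ν := by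
  have hG : ∀ x y : ℝ, 0 < y → cauchyTransform μ ((x : ℂ) + (y : ℂ) * Complex.I)
      = cauchyTransform ν ((x : ℂ) + (y : ℂ) * Complex.I) := fun x y hy => h _ (by simpa using hy)
  have hatom : ∀ a : ℝ, (μ {a}).toReal = (ν {a}).toReal := fun a => by
    have heq := tendsto_nhds_unique_of_eventuallyEq (tendsto_mul_cauchyTransform μ a)
      (tendsto_mul_cauchyTransform ν a) (by
        filter_upwards [self_mem_nhdsWithin] with y hy
        rw [hG a y hy])
    exact_mod_cast heq
  refine Real.measure_ext_Ioo_rat fun p q => ?_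
  rcases lt_or_ge (p : ℝ) (q : ℝ) with hpq | hpq
  · have heq := tendsto_nhds_unique_of_eventuallyEq
      (tendsto_intervalIntegral_im_cauchyTransform μ hpq)
      (tendsto_intervalIntegral_im_cauchyTransform ν hpq) (by
        filter_upwards [self_mem_nhdsWithin] with y hy
        simp_rw [hG _ y hy])
    rw [hatom, hatom] at heq
    exact (ENNReal.toReal_eq_toReal_iff' (measure_ne_top _ _) (measure_ne_top _ _)).1 (by linarith)
  · simp [Ioo_eq_empty hpq.not_gt]

/-- Stieltjes–Perron inversion formula. -/
theorem stieltjes_perron_inversion (μ : Measure ℝ) [IsProbabilityMeasure μ] :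
    (∀ a b : ℝ, a < b →
      Tendsto
        (fun y : ℝ => -(1 / Real.pi) *
          ∫ x in a..b, (cauchyTransform μ ((x : ℂ) + (y : ℂ) * Complex.I)).im)
        (nhdsWithin 0 (Set.Ioi 0))
        (nhds ((μ (Set.Ioo a b)).toReal
          + (1 / 2) * (μ {a}).toReal + (1 / 2) * (μ {b}).toReal)))
    ∧ (∀ a : ℝ,
      Tendsto
        (fun y : ℝ => ((y : ℂ) * Complex.I) *
          cauchyTransform μ ((a : ℂ) + (y : ℂ) * Complex.I))
        (nhdsWithin 0 (Set.Ioi 0))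
        (nhds ((μ {a}).toReal : ℂ)))
    ∧ (∀ ν : Measure ℝ, IsProbabilityMeasure ν →
        (∀ z : ℂ, 0 < z.im → cauchyTransform μ z = cauchyTransform ν z) → μ = ν) := by
  exact ⟨fun _ _ hab => tendsto_intervalIntegral_im_cauchyTransform μ hab,
    tendsto_mul_cauchyTransform μ, fun ν _ h => measure_ext_of_cauchyTransform μ ν h⟩
end

section
/- Characterization of Cauchy transforms: let f : ℍ → ℂ be holomorphic with Im f(z) < 0 for all z ∈ ℍ. Then there exists a Borel probability measure μ on ℝ with f = G_μ on ℍ if and only if lim_{y→∞} (iy)·f(iy) = 1. -/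
open MeasureTheory Filter Topology Set

open Metric in
/-- **Schwarz integral formula** on the unit disc. -/
theorem DiffContOnCl.circleAverage_herglotzRieszKernel_mul_re {h : ℂ → ℂ}
    (hh : DiffContOnCl ℂ h (ball 0 1)) {w : ℂ} (hw : w ∈ ball (0 : ℂ) 1) :
    Real.circleAverage (fun ζ ↦ herglotzRieszKernel 0 w ζ * ((h ζ).re : ℂ)) 0 1
      = h w - (h 0).im * Complex.I := by
  have hw1 : ‖w‖ < 1 := by simpa using hw
  have hcont : ContinuousOn h (sphere 0 |1|) := by
    refine hh.2.mono ?_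
    rw [closure_ball _ one_ne_zero, abs_one]
    exact sphere_subset_closedBall
  have hker : ContinuousOn (herglotzRieszKernel 0 w) (sphere 0 |1|) :=
    continuousOn_herglotzRieszKernel_sphere hw
  have hden : ∀ ζ : ℂ, ‖ζ‖ ≤ 1 → 1 - star w * ζ ≠ 0 := by
    intro ζ hζ h0
    have : ‖star w * ζ‖ < 1 := by
      rw [norm_mul, norm_star]
      nlinarith [norm_nonneg w, norm_nonneg ζ]
    rw [← sub_eq_zero.1 h0] at this
    simp at this
  have hA : Real.circleAverage (fun ζ ↦ herglotzRieszKernel 0 w ζ * h ζ) 0 1 = 2 * h w - h 0 := by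
    have hden' : ∀ ζ ∈ sphere (0 : ℂ) |1|, ζ - w ≠ 0 := by
      intro ζ hζ h0
      rw [sub_eq_zero.1 h0] at hζ
      simp at hζ; linarith
    have e : Real.circleAverage (fun ζ ↦ herglotzRieszKernel 0 w ζ * h ζ) 0 1 =
        Real.circleAverage (fun ζ ↦ (2 : ℝ) • (((ζ - 0) / (ζ - w)) • h ζ) - h ζ) 0 1 := by
      refine Real.circleAverage_congr_sphere fun ζ hζ ↦ ?_
      have := hden' ζ hζ
      simp [herglotzRieszKernel_def]
      field_simp
      ring
    have hh' : DiffContOnCl ℂ h (ball 0 |1|) := by rwa [abs_one]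
    rw [e, Real.circleAverage_fun_sub, Real.circleAverage_fun_smul,
      hh'.circleAverage_smul_div (by rwa [abs_one]), hh'.circleAverage]
    · simp
    · exact ContinuousOn.circleIntegrable' (by fun_prop (disch := assumption))
    · exact hcont.circleIntegrable'
  have hB : Real.circleAverage (fun ζ ↦ star (herglotzRieszKernel 0 w ζ) * h ζ) 0 1 = h 0 := by
    have hd : DiffContOnCl ℂ (fun ζ ↦ ((1 + star w * ζ) / (1 - star w * ζ)) • h ζ)
        (ball 0 |1|) := by
      rw [abs_one]
      refine DiffContOnCl.smul (DifferentiableOn.diffContOnCl ?_) hh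
      rw [closure_ball _ one_ne_zero]
      have : ∀ ζ ∈ closedBall (0 : ℂ) 1, 1 - star w * ζ ≠ 0 := fun ζ hζ ↦ hden ζ (by simpa using hζ)
      fun_prop (disch := assumption)
    have := hd.circleAverage
    simp only [mul_zero, add_zero, sub_zero, div_one, one_smul] at this
    rw [← this]
    refine Real.circleAverage_congr_sphere fun ζ hζ ↦ ?_
    have hζ1 : ‖ζ‖ = 1 := by simpa using hζ
    have hs : ζ * star ζ = 1 := by
      have := Complex.mul_conj' ζ
      rw [hζ1] at this
      simpa using this
    have h0 : star ζ - star w ≠ 0 := by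
      intro h0
      apply hden ζ hζ1.le
      linear_combination ζ * h0 - hs
    have h1 := hden ζ hζ1.le
    simp only [herglotzRieszKernel_def, sub_zero, star_div₀, star_add, star_sub, smul_eq_mul]
    congr 1
    rw [div_eq_div_iff h0 h1]
    linear_combination (-2 * star w) * hs
  have hC : Real.circleAverage (fun ζ ↦ herglotzRieszKernel 0 w ζ * star (h ζ)) 0 1
      = star (h 0) := by
    have hi : CircleIntegrable (fun ζ ↦ star (herglotzRieszKernel 0 w ζ) * h ζ) 0 1 :=
      ContinuousOn.circleIntegrable' (hker.star.mul hcont)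
    have := Complex.conjCLE.toContinuousLinearMap.circleAverage_comp_comm hi
    rw [hB] at this
    refine Eq.trans ?_ this
    congr 1
    ext ζ
    simp
  have e : (fun ζ ↦ herglotzRieszKernel 0 w ζ * ((h ζ).re : ℂ)) = fun ζ ↦ (1 / 2 : ℝ) •
      (herglotzRieszKernel 0 w ζ * h ζ + herglotzRieszKernel 0 w ζ * star (h ζ)) := by
    ext ζ
    rw [Complex.re_eq_add_conj]
    simp
    ring
  rw [e, Real.circleAverage_fun_smul, Real.circleAverage_fun_add, hA, hC]
  · have := Complex.im_eq_sub_conj (h 0)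
    rw [this]
    simp
    field_simp
    ring
  · exact (hker.mul hcont).circleIntegrable'
  · exact (hker.mul hcont.star).circleIntegrable'

open Metric in
/-- **Herglotz representation theorem**, with the measure on the circle parametrized by angles. -/
theorem exists_measure_eq_integral_herglotzRieszKernel {h : ℂ → ℂ}
    (hd : DifferentiableOn ℂ h (ball 0 1)) (hpos : ∀ w ∈ ball (0 : ℂ) 1, 0 ≤ (h w).re) :
    ∃ ν : Measure ℝ, IsFiniteMeasure ν ∧ ∀ w ∈ ball (0 : ℂ) 1,
      h w = (h 0).im * Complex.I + ∫ θ, herglotzRieszKernel 0 w (circleMap 0 1 θ) ∂ν := by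
  have hmaps : ∀ r ∈ Ioo (0 : ℝ) 1, ∀ ζ : ℂ, ‖ζ‖ ≤ 1 → (r : ℂ) * ζ ∈ ball (0 : ℂ) 1 := by
    intro r hr ζ hζ
    simp only [mem_ball, dist_zero_right, norm_mul, Complex.norm_real, Real.norm_eq_abs,
      abs_of_pos hr.1]
    nlinarith [hr.1, hr.2, norm_nonneg ζ]
  have hdil : ∀ r ∈ Ioo (0 : ℝ) 1, DiffContOnCl ℂ (fun ζ ↦ h (r * ζ)) (ball 0 1) := by
    intro r hr
    refine DifferentiableOn.diffContOnCl ?_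
    rw [closure_ball _ one_ne_zero]
    exact hd.comp (by fun_prop) fun ζ hζ ↦ hmaps r hr ζ (by simpa using hζ)
  -- the density of the representing measure of the dilate `ζ ↦ h (r * ζ)`
  let u : ℝ → ℝ → ℝ := fun r θ ↦ (2 * Real.pi)⁻¹ * (h (r * circleMap 0 1 θ)).re
  have hu0 : ∀ r ∈ Ioo (0 : ℝ) 1, ∀ θ, 0 ≤ u r θ := fun r hr θ ↦
    mul_nonneg (by positivity) (hpos _ (hmaps r hr _ (by simp)))
  have huc : ∀ r ∈ Ioo (0 : ℝ) 1, Continuous (u r) := by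
    intro r hr
    refine continuous_const.mul (Complex.continuous_re.comp ?_)
    exact hd.continuousOn.comp_continuous (by fun_prop) fun θ ↦ hmaps r hr _ (by simp)
  let ν : ℝ → Measure ℝ := fun r ↦
    (volume.restrict (Ioc 0 (2 * Real.pi))).withDensity fun θ ↦ ((u r θ).toNNReal : ENNReal)
  have hintegral : ∀ r ∈ Ioo (0 : ℝ) 1, ∀ g : ℝ → ℂ,
      ∫ θ, g θ ∂ν r = ∫ θ in (0)..(2 * Real.pi), (u r θ : ℂ) * g θ := by
    intro r hr g
    rw [integral_withDensity_eq_integral_smul (huc r hr).measurable.real_toNNReal,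
      intervalIntegral.integral_of_le (by positivity)]
    refine integral_congr_ae (.of_forall fun θ ↦ ?_)
    simp [NNReal.smul_def, hu0 r hr θ]
  have hmass : ∀ r ∈ Ioo (0 : ℝ) 1, ν r univ = ENNReal.ofReal (h 0).re := by
    intro r hr
    rw [withDensity_apply _ MeasurableSet.univ, Measure.restrict_univ]
    change ∫⁻ θ, ENNReal.ofReal (u r θ) ∂_ = _
    rw [← ofReal_integral_eq_lintegral_ofReal
      ((huc r hr).integrableOn_Icc.mono_set Ioc_subset_Icc_self)
      (.of_forall (hu0 r hr)), ← intervalIntegral.integral_of_le (by positivity)]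
    congr 1
    have hh' : DiffContOnCl ℂ (fun ζ ↦ h (r * ζ)) (ball 0 |1|) := by
      rw [abs_one]; exact hdil r hr
    have hi : CircleIntegrable (fun ζ ↦ h (r * ζ)) 0 1 := by
      refine ContinuousOn.circleIntegrable' ((hdil r hr).2.mono ?_)
      rw [closure_ball _ one_ne_zero, abs_one]
      exact sphere_subset_closedBall
    have := Complex.reCLM.circleAverage_comp_comm hi
    rw [hh'.circleAverage] at this
    simpa [Real.circleAverage_def, u, Function.comp_def] using this
  have hrep : ∀ r ∈ Ioo (0 : ℝ) 1, ∀ w ∈ ball (0 : ℂ) 1,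
      ∫ θ, herglotzRieszKernel 0 w (circleMap 0 1 θ) ∂ν r = h (r * w) - (h 0).im * Complex.I := by
    intro r hr w hw
    have := (hdil r hr).circleAverage_herglotzRieszKernel_mul_re hw
    rw [hintegral r hr]
    simp only [mul_zero] at this
    rw [← this, Real.circleAverage_def, ← intervalIntegral.integral_smul]
    congr 1
    ext θ
    simp [u]
    ring
  have hfin : ∀ r ∈ Ioo (0 : ℝ) 1, IsFiniteMeasure (ν r) := fun r hr ↦
    ⟨by rw [hmass r hr]; exact ENNReal.ofReal_lt_top⟩
  classical
  let N : ℝ → FiniteMeasure ℝ := fun r ↦ if hr : r ∈ Ioo (0 : ℝ) 1 then ⟨ν r, hfin r hr⟩ else 0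
  have hN : ∀ r ∈ Ioo (0 : ℝ) 1, (N r : Measure ℝ) = ν r := by
    intro r hr
    have : N r = ⟨ν r, hfin r hr⟩ := dif_pos hr
    rw [this]
    rfl
  have hIoo : ∀ᶠ r in 𝓝[<] (1 : ℝ), r ∈ Ioo (0 : ℝ) 1 := Ioo_mem_nhdsLT one_pos
  let U : Ultrafilter ℝ := Ultrafilter.of (𝓝[<] (1 : ℝ))
  have hU : (U : Filter ℝ) ≤ 𝓝[<] 1 := Ultrafilter.of_le _
  obtain ⟨ρ, -, hρ⟩ := (isCompact_setOfPred_finiteMeasure_le_of_isCompact (h 0).re.toNNReal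
    (isCompact_Icc (a := (0 : ℝ)) (b := 2 * Real.pi))).ultrafilter_le_nhds (U.map N) (by
      rw [le_principal_iff]
      refine hU (hIoo.mono fun r hr ↦ ⟨?_, ?_⟩)
      · rw [← ENNReal.coe_le_coe, FiniteMeasure.ennreal_mass, hN r hr, hmass r hr]
        rfl
      · rw [← ENNReal.coe_eq_zero, FiniteMeasure.ennreal_coeFn_eq_coeFn_toMeasure, hN r hr]
        refine withDensity_absolutelyContinuous _ _ ?_
        rw [Measure.restrict_apply measurableSet_Icc.compl]
        convert measure_empty (μ := volume)
        rw [← disjoint_iff_inter_eq_empty]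
        exact disjoint_compl_left.mono_right Ioc_subset_Icc_self)
  have hρ' : Tendsto N U (𝓝 ρ) := hρ
  refine ⟨ρ, inferInstance, fun w hw ↦ ?_⟩
  have hc : Continuous fun θ ↦ herglotzRieszKernel 0 w (circleMap 0 1 θ) :=
    (continuousOn_herglotzRieszKernel_sphere hw).comp_continuous (by fun_prop) (by simp)
  obtain ⟨C, hC⟩ := (isCompact_sphere (0 : ℂ) |1|).exists_bound_of_continuousOn
    (continuousOn_herglotzRieszKernel_sphere hw)
  let g : BoundedContinuousFunction ℝ ℂ := .ofNormedAddCommGroup _ hc C fun θ ↦ hC _ (by simp)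
  have h1 : Tendsto (fun r ↦ ∫ θ, g θ ∂(N r : Measure ℝ)) U (𝓝 (∫ θ, g θ ∂(ρ : Measure ℝ))) :=
    (FiniteMeasure.tendsto_iff_forall_integral_rclike_tendsto ℂ).1 hρ' g
  have h2 : Tendsto (fun r ↦ ∫ θ, g θ ∂(N r : Measure ℝ)) U
      (𝓝 (h w - (h 0).im * Complex.I)) := by
    have h3 : Tendsto (fun r : ℝ ↦ h (r * w) - (h 0).im * Complex.I) (𝓝[<] 1)
        (𝓝 (h w - (h 0).im * Complex.I)) := by
      refine Tendsto.sub_const ?_ _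
      have h4 : ContinuousAt h ((1 : ℝ) * w) := by
        rw [Complex.ofReal_one, one_mul]
        exact (hd.differentiableAt (isOpen_ball.mem_nhds hw)).continuousAt
      have h5 : ContinuousAt (fun r : ℝ ↦ h (r * w)) 1 :=
        ContinuousAt.comp (f := fun r : ℝ ↦ (r : ℂ) * w) h4 (by fun_prop)
      have h6 := h5.tendsto.mono_left (nhdsWithin_le_nhds (s := Iio 1))
      simpa using h6
    refine (h3.congr' (hIoo.mono fun r hr ↦ ?_)).mono_left hU
    rw [hN r hr, ← hrep r hr w hw]
    rfl
  have := tendsto_nhds_unique h1 h2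
  change h w = _ + ∫ θ, g θ ∂(ρ : Measure ℝ)
  rw [this]
  ring

/-- **Nevanlinna representation** of holomorphic maps from the upper to the lower half-plane. -/
theorem exists_nevanlinna_representation {f : ℂ → ℂ}
    (hf : DifferentiableOn ℂ f {z : ℂ | 0 < z.im})
    (hneg : ∀ z : ℂ, 0 < z.im → (f z).im < 0) :
    ∃ (β m : ℝ) (ν : Measure ℝ), 0 ≤ m ∧ IsFiniteMeasure ν ∧ ∀ z : ℂ, 0 < z.im →
      f z = β - m * z + ∫ x : ℝ, (1 + x * z) / (z - x) ∂ν := by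
  have hne : ∀ w ∈ Metric.ball (0 : ℂ) 1, 1 - w ≠ 0 := by
    intro w hw h0
    rw [← sub_eq_zero.1 h0] at hw
    simp at hw
  have him : ∀ w ∈ Metric.ball (0 : ℂ) 1, 0 < (Complex.I * (1 + w) / (1 - w)).im := by
    intro w hw
    have hns : 0 < Complex.normSq (1 - w) := Complex.normSq_pos.2 (hne w hw)
    have hw1 : Complex.normSq w < 1 := by
      rw [Complex.normSq_eq_norm_sq]
      have : ‖w‖ < 1 := by simpa using hw
      nlinarith [norm_nonneg w]
    rw [Complex.normSq_apply] at hw1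
    rw [Complex.div_im, ← sub_div]
    refine div_pos ?_ hns
    simp
    nlinarith
  obtain ⟨ρ, hρ, hrep⟩ := exists_measure_eq_integral_herglotzRieszKernel
    (h := fun w ↦ Complex.I * f (Complex.I * (1 + w) / (1 - w)))
    ((differentiableOn_const _).mul
      (hf.comp (by fun_prop (disch := assumption)) fun w hw ↦ him w hw))
    (fun w hw ↦ by simpa using (hneg _ (him w hw)).le)
  generalize ((fun w ↦ Complex.I * f (Complex.I * (1 + w) / (1 - w))) 0).im = β at hrep
  let A : Set ℝ := {θ | circleMap 0 1 θ = 1}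
  have hA : MeasurableSet A := (isClosed_eq (by fun_prop) (by fun_prop)).measurableSet
  let T : ℝ → ℝ := fun θ ↦ (Complex.I * (1 + circleMap 0 1 θ) / (1 - circleMap 0 1 θ)).re
  have hT : Measurable T := by fun_prop
  refine ⟨β, ρ.real A, (ρ.restrict Aᶜ).map T, measureReal_nonneg, inferInstance, fun z hz ↦ ?_⟩
  have hzI : z + Complex.I ≠ 0 := by
    intro h0
    have := congrArg Complex.im h0
    simp at this
    linarith
  have hw : (z - Complex.I) / (z + Complex.I) ∈ Metric.ball (0 : ℂ) 1 := by
    rw [mem_ball_zero_iff, norm_div, div_lt_one (norm_pos_iff.2 hzI)]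
    rw [← sq_lt_sq₀ (norm_nonneg _) (norm_nonneg _), ← Complex.normSq_eq_norm_sq,
      ← Complex.normSq_eq_norm_sq, Complex.normSq_apply, Complex.normSq_apply]
    simp
    nlinarith
  set w := (z - Complex.I) / (z + Complex.I) with hwdef
  have hφ : Complex.I * (1 + w) / (1 - w) = z := by
    rw [div_eq_iff (hne w hw), hwdef]
    field_simp
    ring
  have hKint : Integrable (fun θ ↦ herglotzRieszKernel 0 w (circleMap 0 1 θ)) ρ := by
    obtain ⟨C, hC⟩ := (isCompact_sphere (0 : ℂ) |1|).exists_bound_of_continuousOn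
      (continuousOn_herglotzRieszKernel_sphere hw)
    refine .of_bound (C := C) ?_ (.of_forall fun θ ↦ hC _ (by simp))
    exact ((continuousOn_herglotzRieszKernel_sphere hw).comp_continuous (by fun_prop)
      (by simp)).aestronglyMeasurable
  have hKA : ∫ θ in A, herglotzRieszKernel 0 w (circleMap 0 1 θ) ∂ρ
      = ρ.real A * (-Complex.I * z) := by
    rw [setIntegral_congr_fun (g := fun _ ↦ -Complex.I * z) hA, setIntegral_const,
      Complex.real_smul]
    intro θ hθ
    have hθ' : circleMap 0 1 θ = 1 := hθ
    simp only [herglotzRieszKernel_def, sub_zero, hθ']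
    rw [← hφ]
    linear_combination ((1 + w) / (1 - w)) * Complex.I_mul_I
  have hKAc : ∫ θ in Aᶜ, herglotzRieszKernel 0 w (circleMap 0 1 θ) ∂ρ
      = Complex.I * ∫ x : ℝ, (1 + x * z) / (z - x) ∂((ρ.restrict Aᶜ).map T) := by
    rw [integral_map hT.aemeasurable (Measurable.aestronglyMeasurable (by fun_prop)),
      ← integral_const_mul]
    refine setIntegral_congr_fun hA.compl fun θ hθ ↦ ?_
    have hθ' : circleMap 0 1 θ ≠ 1 := hθ
    have hn : ‖circleMap 0 1 θ‖ = 1 := by simp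
    have hTθ : (T θ : ℂ) = Complex.I * (1 + circleMap 0 1 θ) / (1 - circleMap 0 1 θ) := by
      apply Complex.ext
      · simp [T]
      · rw [Complex.ofReal_im, Complex.div_im, ← sub_div]
        have : Complex.normSq (circleMap 0 1 θ) = 1 := by
          rw [Complex.normSq_eq_norm_sq, hn, one_pow]
        rw [Complex.normSq_apply] at this
        symm
        rw [div_eq_zero_iff]
        left
        simp only [Complex.mul_im, Complex.mul_re, Complex.I_re, Complex.I_im, Complex.add_re,
          Complex.add_im, Complex.sub_re, Complex.sub_im, Complex.one_re, Complex.one_im]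
        linear_combination -this
    have h1 : circleMap 0 1 θ - w ≠ 0 := sub_ne_zero.2 (circleMap_ne_mem_ball hw θ)
    have h2 : 1 - circleMap 0 1 θ ≠ 0 := sub_ne_zero.2 hθ'.symm
    have h3 := hne w hw
    have hzT : z - T θ = -2 * Complex.I * (circleMap 0 1 θ - w) /
        ((1 - w) * (1 - circleMap 0 1 θ)) := by
      rw [hTθ, ← hφ]
      field_simp
      ring
    have hzT' : 1 + T θ * z = -2 * (circleMap 0 1 θ + w) /
        ((1 - w) * (1 - circleMap 0 1 θ)) := by
      rw [hTθ, ← hφ]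
      field_simp
      linear_combination ((1 + circleMap 0 1 θ) * (1 + w)) * Complex.I_sq
    simp only [herglotzRieszKernel_def, sub_zero]
    rw [hzT, hzT']
    field_simp
  have := hrep w hw
  rw [← integral_add_compl hA hKint, hKA, hKAc, hφ] at this
  have hI := Complex.I_mul_I
  linear_combination (-Complex.I) * this +
    (f z - β - (∫ x : ℝ, (1 + x * z) / (z - x) ∂((ρ.restrict Aᶜ).map T)) + ρ.real A * z) * hI

theorem sub_ofReal_ne_zero_of_im_pos {z : ℂ} (hz : 0 < z.im) (x : ℝ) : z - x ≠ 0 := by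
  intro h
  have := congrArg Complex.im h
  simp at this
  linarith

theorem im_le_norm_sub_ofReal {z : ℂ} (hz : 0 < z.im) (x : ℝ) : z.im ≤ ‖z - x‖ := by
  simpa [abs_of_pos hz] using Complex.abs_im_le_norm (z - x)

/-- `i y G_μ(i y) → 1` as `y → ∞` for a probability measure `μ`. -/
theorem tendsto_mul_cauchyTransform_atTop (μ : Measure ℝ) [IsProbabilityMeasure μ] :
    Tendsto (fun y : ℝ ↦ ((y : ℂ) * Complex.I) * cauchyTransform μ ((y : ℂ) * Complex.I))
      atTop (𝓝 1) := by
  have h1 : (1 : ℂ) = ∫ _ : ℝ, (1 : ℂ) ∂μ := by simp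
  simp only [cauchyTransform, ← integral_const_mul]
  rw [h1]
  refine tendsto_integral_filter_of_dominated_convergence (fun _ ↦ 1) ?_ ?_
    (integrable_const _) ?_
  · exact .of_forall fun y ↦ Measurable.aestronglyMeasurable (by fun_prop)
  · filter_upwards [eventually_gt_atTop 0] with y hy
    refine .of_forall fun x ↦ ?_
    have hz : 0 < ((y : ℂ) * Complex.I).im := by simpa using hy
    have := im_le_norm_sub_ofReal hz x
    rw [norm_mul, norm_inv, ← div_eq_mul_inv]
    refine div_le_one_of_le₀ ?_ (norm_nonneg _)
    simpa [abs_of_pos hy] using this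
  · refine .of_forall fun x ↦ ?_
    have h2 : Tendsto (fun y : ℝ ↦ (x : ℂ) * ((y : ℂ) * Complex.I - x)⁻¹) atTop (𝓝 0) := by
      rw [← mul_zero (x : ℂ)]
      refine Tendsto.const_mul _ (squeeze_zero_norm' (a := fun y : ℝ ↦ y⁻¹) ?_
        tendsto_inv_atTop_zero)
      filter_upwards [eventually_gt_atTop 0] with y hy
      have hz : 0 < ((y : ℂ) * Complex.I).im := by simpa using hy
      have := im_le_norm_sub_ofReal hz x
      rw [norm_inv]
      refine inv_anti₀ hy ?_
      simpa using this
    have h3 := h2.const_add 1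
    rw [add_zero] at h3
    refine h3.congr' ?_
    filter_upwards [eventually_gt_atTop 0] with y hy
    have hz : 0 < ((y : ℂ) * Complex.I).im := by simpa using hy
    have := sub_ofReal_ne_zero_of_im_pos hz x
    field_simp
    ring

/-- A Nevanlinna representation of a function with `i y f(i y) → 1` is a Cauchy transform. -/
theorem exists_eq_cauchyTransform_of_nevanlinna {f : ℂ → ℂ} {β m : ℝ} {ν : Measure ℝ}
    (hm : 0 ≤ m) [IsFiniteMeasure ν]
    (hrep : ∀ z : ℂ, 0 < z.im → f z = β - m * z + ∫ x : ℝ, (1 + x * z) / (z - x) ∂ν)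
    (hlim : Tendsto (fun y : ℝ ↦ ((y : ℂ) * Complex.I) * f ((y : ℂ) * Complex.I))
      atTop (𝓝 1)) :
    ∃ μ : Measure ℝ, IsProbabilityMeasure μ ∧
      ∀ z : ℂ, 0 < z.im → f z = cauchyTransform μ z := by
  let k : ℝ → ℝ → ℝ := fun y x ↦ y ^ 2 * (1 + x ^ 2) / (x ^ 2 + y ^ 2)
  have hk0 : ∀ y x, 0 ≤ k y x := fun y x ↦ by positivity
  have hkm : ∀ y, Measurable (k y) := fun y ↦ by fun_prop
  have hkint : ∀ y, Integrable (k y) ν := by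
    intro y
    refine .of_bound (C := 1 + y ^ 2) (hkm y).aestronglyMeasurable (.of_forall fun x ↦ ?_)
    rw [Real.norm_of_nonneg (hk0 y x)]
    refine div_le_of_le_mul₀ (by positivity) (by positivity) ?_
    nlinarith [sq_nonneg x, sq_nonneg y, sq_nonneg (x * y), sq_nonneg (y ^ 2)]
  have hintegral : ∀ z : ℂ, 0 < z.im → Integrable (fun x : ℝ ↦ (1 + x * z) / (z - x)) ν := by
    intro z hz
    refine .of_bound (C := ‖1 + z ^ 2‖ / z.im + ‖z‖)
      (Measurable.aestronglyMeasurable (by fun_prop)) (.of_forall fun x ↦ ?_)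
    have h0 := sub_ofReal_ne_zero_of_im_pos hz x
    have e : (1 + x * z) / (z - x) = (1 + z ^ 2) / (z - x) - z := by
      field_simp
      ring
    rw [e]
    refine (norm_sub_le _ _).trans ?_
    rw [norm_div]
    gcongr
    exact im_le_norm_sub_ofReal hz x
  have hre : ∀ y : ℝ, 0 < y → (((y : ℂ) * Complex.I) * f ((y : ℂ) * Complex.I)).re
      = m * y ^ 2 + ∫ x, k y x ∂ν := by
    intro y hy
    have hz : 0 < ((y : ℂ) * Complex.I).im := by simpa using hy
    have h1 : (∫ x : ℝ, (1 + x * ((y : ℂ) * Complex.I)) / ((y : ℂ) * Complex.I - x) ∂ν).im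
        = ∫ x : ℝ, ((1 + x * ((y : ℂ) * Complex.I)) / ((y : ℂ) * Complex.I - x)).im ∂ν :=
      (Complex.imCLM.integral_comp_comm (hintegral _ hz)).symm
    have h2 : ∫ x, k y x ∂ν = -y *
        ∫ x : ℝ, ((1 + x * ((y : ℂ) * Complex.I)) / ((y : ℂ) * Complex.I - x)).im ∂ν := by
      rw [← integral_const_mul]
      refine integral_congr_ae (.of_forall fun x ↦ ?_)
      simp only [k]
      rw [Complex.div_im, Complex.normSq_apply]
      simp
      rw [← sq x, ← sq y]
      have : x ^ 2 + y ^ 2 ≠ 0 := by positivity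
      field_simp
      ring
    rw [hrep _ hz, h2, ← h1]
    simp
    ring
  have hlim1 : Tendsto (fun y : ℝ ↦ m * y ^ 2 + ∫ x, k y x ∂ν) atTop (𝓝 1) := by
    have := (Complex.continuous_re.tendsto 1).comp hlim
    rw [Complex.one_re] at this
    refine this.congr' ?_
    filter_upwards [eventually_gt_atTop 0] with y hy using hre y hy
  have hm0 : m = 0 := by
    by_contra hne
    have hm' : 0 < m := lt_of_le_of_ne hm (Ne.symm hne)
    have h1 : Tendsto (fun y : ℝ ↦ m * y ^ 2) atTop atTop :=
      (tendsto_pow_atTop two_ne_zero).const_mul_atTop hm'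
    have h2 := tendsto_atTop_mono
      (fun y ↦ le_add_of_nonneg_right (integral_nonneg (μ := ν) (hk0 y))) h1
    exact not_tendsto_nhds_of_tendsto_atTop h2 1 hlim1
  subst hm0
  simp only [zero_mul, zero_add] at hlim1
  have hmass : ∫⁻ x, ENNReal.ofReal (1 + x ^ 2) ∂ν = 1 := by
    have h1 : Tendsto (fun n : ℕ ↦ ∫⁻ x, ENNReal.ofReal (k n x) ∂ν) atTop (𝓝 1) := by
      have := (ENNReal.continuous_ofReal.tendsto 1).comp
        (hlim1.comp tendsto_natCast_atTop_atTop)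
      rw [ENNReal.ofReal_one] at this
      refine this.congr fun n ↦ ?_
      exact ofReal_integral_eq_lintegral_ofReal (hkint n) (.of_forall (hk0 n))
    refine tendsto_nhds_unique (lintegral_tendsto_of_tendsto_of_monotone
      (fun n : ℕ ↦ (hkm n).ennreal_ofReal.aemeasurable) (.of_forall fun x ↦ ?_)
      (.of_forall fun x ↦ ?_)) h1
    · intro a b hab
      refine ENNReal.ofReal_le_ofReal ?_
      simp only [k]
      have hab' : (a : ℝ) ≤ b := by exact_mod_cast hab
      rcases Nat.eq_zero_or_pos a with rfl | ha
      · simp only [Nat.cast_zero, ne_eq, OfNat.ofNat_ne_zero, not_false_eq_true, zero_pow,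
          zero_mul, zero_div]
        positivity
      · have ha' : (0 : ℝ) < a := by exact_mod_cast ha
        have hb' : (0 : ℝ) < b := ha'.trans_le hab'
        rw [div_le_div_iff₀ (by positivity) (by positivity)]
        have : (a : ℝ) ^ 2 ≤ b ^ 2 := by gcongr
        nlinarith [mul_nonneg (mul_nonneg (sq_nonneg x) (by positivity : 0 ≤ 1 + x ^ 2))
          (sub_nonneg.2 this)]
    · refine (ENNReal.continuous_ofReal.tendsto _).comp ?_
      have hinv : Tendsto (fun n : ℕ ↦ 1 + x ^ 2 * ((n : ℝ)⁻¹) ^ 2) atTop (𝓝 (1 + x ^ 2 * 0 ^ 2)) :=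
        ((tendsto_inv_atTop_zero.comp tendsto_natCast_atTop_atTop).pow 2).const_mul _ |>.const_add _
      have h2 := (tendsto_const_nhds (x := 1 + x ^ 2)).div hinv (by simp)
      simp only [ne_eq, OfNat.ofNat_ne_zero, not_false_eq_true, zero_pow, mul_zero, add_zero,
        div_one] at h2
      refine h2.congr' ?_
      filter_upwards [eventually_gt_atTop 0] with n hn
      have hn' : (0 : ℝ) < n := by exact_mod_cast hn
      simp only [k, Pi.div_apply]
      field_simp
      ring
  have hμ : IsProbabilityMeasure (ν.withDensity fun x ↦ ((1 + x ^ 2).toNNReal : ENNReal)) :=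
    ⟨by rw [withDensity_apply _ MeasurableSet.univ, Measure.restrict_univ]; exact hmass⟩
  have hsq : Integrable (fun x : ℝ ↦ 1 + x ^ 2) ν := by
    refine ⟨Measurable.aestronglyMeasurable (by fun_prop), ?_⟩
    rw [hasFiniteIntegral_iff_ofReal (.of_forall fun x ↦ by positivity), hmass]
    exact ENNReal.one_lt_top
  have hid : Integrable (fun x : ℝ ↦ (x : ℂ)) ν := by
    refine hsq.mono' (Measurable.aestronglyMeasurable (by fun_prop)) (.of_forall fun x ↦ ?_)
    rw [Complex.norm_real, Real.norm_eq_abs]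
    nlinarith [sq_abs x, sq_nonneg (|x| - 1), abs_nonneg x]
  set μ := ν.withDensity fun x ↦ ((1 + x ^ 2).toNNReal : ENNReal) with hμdef
  have hG : ∀ z : ℂ, 0 < z.im → f z = (β + ∫ x : ℝ, (x : ℂ) ∂ν) + cauchyTransform μ z := by
    intro z hz
    have h1 : cauchyTransform μ z = ∫ x : ℝ, ((1 + x * z) / (z - x) - x) ∂ν := by
      rw [cauchyTransform, hμdef, integral_withDensity_eq_integral_smul (by fun_prop)]
      refine integral_congr_ae (.of_forall fun x ↦ ?_)
      have h0 := sub_ofReal_ne_zero_of_im_pos hz x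
      simp only [NNReal.smul_def]
      rw [Real.coe_toNNReal _ (by positivity), Complex.real_smul]
      push_cast
      field_simp
      ring
    rw [h1, integral_sub (hintegral z hz) hid, hrep z hz]
    simp
  refine ⟨μ, hμ, fun z hz ↦ ?_⟩
  suffices hc : (β + ∫ x : ℝ, (x : ℂ) ∂ν : ℂ) = 0 by rw [hG z hz, hc, zero_add]
  generalize (β + ∫ x : ℝ, (x : ℂ) ∂ν : ℂ) = c at hG
  have h1 := hlim.sub (tendsto_mul_cauchyTransform_atTop μ)
  rw [sub_self] at h1
  have h2 : Tendsto (fun y : ℝ ↦ ((y : ℂ) * Complex.I) * c) atTop (𝓝 0) := by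
    refine h1.congr' ?_
    filter_upwards [eventually_gt_atTop 0] with y hy
    rw [hG _ (by simpa using hy)]
    ring
  by_contra hc
  have h3 : Tendsto (fun y : ℝ ↦ y * ‖c‖) atTop (𝓝 0) := by
    have := h2.norm
    rw [norm_zero] at this
    refine this.congr' ?_
    filter_upwards [eventually_gt_atTop 0] with y hy
    simp [abs_of_pos hy]
  exact not_tendsto_nhds_of_tendsto_atTop
    (tendsto_id.atTop_mul_const (norm_pos_iff.2 hc)) 0 h3

/-- Characterization of Cauchy transforms: a holomorphic map of the upper half-plane
into the lower half-plane is the Cauchy transform of a probability measure on ℝ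
iff `(iy)·f(iy) → 1` as `y → ∞`. -/
theorem cauchyTransform_characterization (f : ℂ → ℂ)
    (hf : DifferentiableOn ℂ f {z : ℂ | 0 < z.im})
    (hneg : ∀ z : ℂ, 0 < z.im → (f z).im < 0) :
    (∃ μ : Measure ℝ, IsProbabilityMeasure μ ∧
        ∀ z : ℂ, 0 < z.im → f z = cauchyTransform μ z)
    ↔ Tendsto (fun y : ℝ => ((y : ℂ) * Complex.I) * f ((y : ℂ) * Complex.I))
        atTop (nhds 1) := by
  constructor
  · rintro ⟨μ, hμ, hfμ⟩
    refine (tendsto_mul_cauchyTransform_atTop μ).congr' ?_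
    filter_upwards [eventually_gt_atTop 0] with y hy
    rw [hfμ _ (by simpa using hy)]
  · intro hlim
    obtain ⟨β, m, ν, hm, hν, hrep⟩ := exists_nevanlinna_representation hf hneg
    exact exists_eq_cauchyTransform_of_nevanlinna hm hrep hlim
end

section
/- Rigidity of expansive self-maps of the half-plane: let f : ℍ → ℂ be holomorphic with Im f(z) ≥ Im z for all z ∈ ℍ. If there exists z₀ ∈ ℍ with Im f(z₀) = Im z₀, then there is a real number a such that f(z) = z + a for all z ∈ ℍ. -/
open Filter Topology Set

/-- Minimum principle for the imaginary part of a holomorphic function. -/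
theorem AnalyticOnNhd.eqOn_const_of_isMinOn_im {g : ℂ → ℂ} {U : Set ℂ} {z₀ : ℂ}
    (hg : AnalyticOnNhd ℂ g U) (hU : IsOpen U) (hc : IsPreconnected U) (hz₀ : z₀ ∈ U)
    (hmin : IsMinOn (fun z ↦ (g z).im) U z₀) : ∀ z ∈ U, g z = g z₀ := by
  rcases hg.is_constant_or_isOpen hc with ⟨w, hw⟩ | hopen
  · intro z hz
    rw [hw z hz, hw z₀ hz₀]
  · have hsub : g '' U ⊆ {w : ℂ | (g z₀).im ≤ w.im} := by
      rintro _ ⟨z, hz, rfl⟩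
      exact hmin hz
    have hmem : g z₀ ∈ interior {w : ℂ | (g z₀).im ≤ w.im} :=
      interior_maximal hsub (hopen U subset_rfl hU) (mem_image_of_mem g hz₀)
    rw [Complex.interior_setOfPred_le_im] at hmem
    exact (lt_irrefl (g z₀).im hmem).elim

/-- Rigidity of expansive self-maps of the upper half-plane: if a holomorphic map `f`
on ℍ satisfies `Im f(z) ≥ Im z` everywhere, with equality at one point, then
`f(z) = z + a` for a real constant `a`. -/
theorem expansive_halfplane_rigidity (f : ℂ → ℂ)
    (hf : DifferentiableOn ℂ f {z : ℂ | 0 < z.im})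
    (hexp : ∀ z : ℂ, 0 < z.im → z.im ≤ (f z).im)
    (z₀ : ℂ) (hz₀ : 0 < z₀.im) (heq : (f z₀).im = z₀.im) :
    ∃ a : ℝ, ∀ z : ℂ, 0 < z.im → f z = z + (a : ℂ) := by
  have hU : IsOpen {z : ℂ | 0 < z.im} := isOpen_lt continuous_const Complex.continuous_im
  have hg : AnalyticOnNhd ℂ (fun z ↦ f z - z) {z : ℂ | 0 < z.im} :=
    (hf.sub differentiableOn_id).analyticOnNhd hU
  have hmin : IsMinOn (fun z ↦ (f z - z).im) {z : ℂ | 0 < z.im} z₀ := fun z hz ↦ by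
    simpa [heq] using hexp z hz
  have hconst := hg.eqOn_const_of_isMinOn_im hU (convex_halfSpace_im_gt 0).isPreconnected hz₀ hmin
  have hreal : (((f z₀ - z₀).re : ℝ) : ℂ) = f z₀ - z₀ := by
    apply Complex.ext <;> simp [heq]
  refine ⟨(f z₀ - z₀).re, fun z hz ↦ ?_⟩
  rw [hreal, ← hconst z hz, add_sub_cancel]
end

section
/- Convergence lemma for Cauchy transforms: let μ and μ₁, μ₂, … be Borel probability measures on ℝ. Then μ_n converges weakly to μ if and only if G_{μ_n} converges to G_μ locally uniformly on ℍ. -/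
open MeasureTheory Filter Topology Set

open scoped BoundedContinuousFunction

lemma norm_inv_sub_ofReal_le {z : ℂ} (hz : 0 < z.im) (x : ℝ) :
    ‖(z - (x : ℂ))⁻¹‖ ≤ z.im⁻¹ := by
  rw [norm_inv]
  refine inv_anti₀ hz ?_
  simpa using (le_abs_self _).trans (Complex.abs_im_le_norm (z - (x : ℂ)))

lemma sub_ofReal_ne_zero {z : ℂ} (hz : 0 < z.im) (x : ℝ) : z - (x : ℂ) ≠ 0 := by
  intro h
  simpa [hz.ne'] using congrArg Complex.im h

/-- The Cauchy kernel `x ↦ 1/(z-x)` as a bounded continuous function on `ℝ`. -/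
noncomputable def cauchyKernel (z : ℂ) (hz : 0 < z.im) : ℝ →ᵇ ℂ :=
  BoundedContinuousFunction.ofNormedAddCommGroup (fun x : ℝ => (z - (x : ℂ))⁻¹)
    (Continuous.inv₀ (by fun_prop) (sub_ofReal_ne_zero hz)) z.im⁻¹ (norm_inv_sub_ofReal_le hz)

@[simp]
lemma cauchyKernel_apply (z : ℂ) (hz : 0 < z.im) (x : ℝ) :
    cauchyKernel z hz x = (z - (x : ℂ))⁻¹ := rfl

lemma integrable_inv_sub_ofReal_pow (μ : Measure ℝ) [IsFiniteMeasure μ] {z : ℂ} (hz : 0 < z.im)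
    (k : ℕ) : Integrable (fun x : ℝ => (z - (x : ℂ))⁻¹ ^ k) μ :=
  (cauchyKernel z hz ^ k).integrable μ

lemma integrable_inv_sub_ofReal (μ : Measure ℝ) [IsFiniteMeasure μ] {z : ℂ} (hz : 0 < z.im) :
    Integrable (fun x : ℝ => (z - (x : ℂ))⁻¹) μ :=
  (cauchyKernel z hz).integrable μ

lemma norm_cauchyTransform_sub_le (μ : Measure ℝ) [IsProbabilityMeasure μ] {z w : ℂ}
    (hz : 0 < z.im) (hw : 0 < w.im) :
    ‖cauchyTransform μ w - cauchyTransform μ z‖ ≤ ‖w - z‖ * (w.im⁻¹ * z.im⁻¹) := by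
  rw [cauchyTransform, cauchyTransform,
    ← integral_sub (integrable_inv_sub_ofReal μ hw) (integrable_inv_sub_ofReal μ hz)]
  refine (norm_integral_le_of_norm_le_const (C := ‖w - z‖ * (w.im⁻¹ * z.im⁻¹))
    (Eventually.of_forall fun x => ?_)).trans_eq (by simp)
  have h : (w - (x : ℂ))⁻¹ - (z - (x : ℂ))⁻¹
      = -((w - z) * ((w - (x : ℂ))⁻¹ * (z - (x : ℂ))⁻¹)) := by
    field_simp [sub_ofReal_ne_zero hz x, sub_ofReal_ne_zero hw x]
    ring
  rw [h, norm_neg, norm_mul, norm_mul]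
  gcongr
  · exact norm_inv_sub_ofReal_le hw x
  · exact norm_inv_sub_ofReal_le hz x

/-- Pointwise convergence of Cauchy transforms is automatically locally uniform. -/
lemma tendstoLocallyUniformlyOn_cauchyTransform (μ : Measure ℝ) (μs : ℕ → Measure ℝ)
    [IsProbabilityMeasure μ] [∀ n, IsProbabilityMeasure (μs n)]
    (h : ∀ z : ℂ, 0 < z.im →
      Tendsto (fun n => cauchyTransform (μs n) z) atTop (𝓝 (cauchyTransform μ z))) :
    TendstoLocallyUniformlyOn (fun n z => cauchyTransform (μs n) z)
      (cauchyTransform μ) atTop {z : ℂ | 0 < z.im} := by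
  rw [Metric.tendstoLocallyUniformlyOn_iff]
  intro ε hε z hz
  have hz' : 0 < z.im := hz
  have hcont : Tendsto (fun w : ℂ => ‖w - z‖ * (w.im⁻¹ * z.im⁻¹)) (𝓝 z) (𝓝 0) := by
    have hc : ContinuousAt (fun w : ℂ => ‖w - z‖ * (w.im⁻¹ * z.im⁻¹)) z :=
      (by fun_prop : ContinuousAt (fun w : ℂ => ‖w - z‖) z).mul
        ((Complex.continuous_im.continuousAt.inv₀ hz'.ne').mul continuousAt_const)
    simpa [ContinuousAt] using hc
  have hmem : {w : ℂ | 0 < w.im ∧ ‖w - z‖ * (w.im⁻¹ * z.im⁻¹) < ε / 3} ∈ 𝓝 z :=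
    ((Complex.continuous_im.tendsto z).eventually_const_lt hz').and
      (hcont.eventually_lt_const (by positivity))
  refine ⟨_, mem_nhdsWithin_of_mem_nhds hmem, ?_⟩
  filter_upwards [Metric.tendsto_nhds.1 (h z hz') (ε / 3) (by positivity)] with n hn w hw
  have h₁ := norm_cauchyTransform_sub_le μ hz' hw.1
  have h₂ := norm_cauchyTransform_sub_le (μs n) hz' hw.1
  rw [← dist_eq_norm] at h₁ h₂
  have h₃ := dist_triangle4 (cauchyTransform μ w) (cauchyTransform μ z)
    (cauchyTransform (μs n) z) (cauchyTransform (μs n) w)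
  rw [dist_comm] at hn h₂
  linarith [hw.2]

lemma hasDerivAt_integral_inv_sub_ofReal_pow (μ : Measure ℝ) [IsFiniteMeasure μ] (k : ℕ) {z : ℂ}
    (hz : 0 < z.im) :
    HasDerivAt (fun w : ℂ => ∫ x : ℝ, (w - (x : ℂ))⁻¹ ^ k ∂μ)
      (-(k : ℂ) * ∫ x : ℝ, (z - (x : ℂ))⁻¹ ^ (k + 1) ∂μ) z := by
  have hs : {w : ℂ | z.im / 2 < w.im} ∈ 𝓝 z :=
    (Complex.continuous_im.tendsto z).eventually_const_lt (half_lt_self hz)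
  have hpos : ∀ w : ℂ, z.im / 2 < w.im → 0 < w.im := fun w hw => (half_pos hz).trans hw
  rw [← integral_const_mul]
  refine (hasDerivAt_integral_of_dominated_loc_of_deriv_le
    (F' := fun (w : ℂ) (x : ℝ) => -(k : ℂ) * (w - (x : ℂ))⁻¹ ^ (k + 1))
    (bound := fun _ => (k : ℝ) * (z.im / 2)⁻¹ ^ (k + 1)) hs ?_
    (integrable_inv_sub_ofReal_pow μ hz k)
    ((integrable_inv_sub_ofReal_pow μ hz (k + 1)).const_mul _).aestronglyMeasurable
    ?_ (integrable_const _) ?_).2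
  · filter_upwards [hs] with w hw
    exact (integrable_inv_sub_ofReal_pow μ (hpos w hw) k).aestronglyMeasurable
  · refine Eventually.of_forall fun x w hw => ?_
    have hw' : z.im / 2 < w.im := hw
    rw [norm_mul, norm_neg, Complex.norm_natCast, norm_pow]
    gcongr
    exact (norm_inv_sub_ofReal_le (hpos w hw) x).trans (inv_anti₀ (half_pos hz) hw'.le)
  · refine Eventually.of_forall fun x w hw => ?_
    have hne := sub_ofReal_ne_zero (hpos w hw) x
    have h := (((hasDerivAt_id w).sub_const (x : ℂ)).inv hne).pow k
    refine h.congr_deriv ?_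
    rcases k with _ | k
    · simp
    · simp only [id, Nat.add_sub_cancel, Pi.inv_apply, div_eq_mul_inv, ← inv_pow]
      ring

lemma tendstoLocallyUniformlyOn_integral_inv_sub_ofReal_pow {μ : Measure ℝ} {μs : ℕ → Measure ℝ}
    [IsFiniteMeasure μ] [∀ n, IsFiniteMeasure (μs n)]
    (h : TendstoLocallyUniformlyOn (fun n z => cauchyTransform (μs n) z)
      (cauchyTransform μ) atTop {z : ℂ | 0 < z.im}) (k : ℕ) :
    TendstoLocallyUniformlyOn (fun n (z : ℂ) => ∫ x : ℝ, (z - (x : ℂ))⁻¹ ^ (k + 1) ∂(μs n))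
      (fun z => ∫ x : ℝ, (z - (x : ℂ))⁻¹ ^ (k + 1) ∂μ) atTop {z : ℂ | 0 < z.im} := by
  have hopen : IsOpen {z : ℂ | 0 < z.im} := isOpen_lt continuous_const Complex.continuous_im
  have hk : ∀ k : ℕ, -((k + 1 : ℕ) : ℂ) ≠ 0 := fun k =>
    neg_ne_zero.2 (by exact_mod_cast k.succ_ne_zero)
  induction k with
  | zero => simpa [cauchyTransform] using! h
  | succ k ih =>
    have hd := ih.deriv (Eventually.of_forall fun n z hz =>
      (hasDerivAt_integral_inv_sub_ofReal_pow (μs n) (k + 1)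
        hz).differentiableAt.differentiableWithinAt) hopen
    have hc := (uniformContinuous_const_smul
      (-((k + 1 : ℕ) : ℂ))⁻¹).comp_tendstoLocallyUniformlyOn hd
    refine (hc.congr fun n z hz => ?_).congr_right fun z hz => ?_
    · simp only [Function.comp_apply, smul_eq_mul,
        (hasDerivAt_integral_inv_sub_ofReal_pow (μs n) (k + 1) hz).deriv]
      exact inv_mul_cancel_left₀ (hk k) _
    · simp only [Function.comp_apply, smul_eq_mul,
        (hasDerivAt_integral_inv_sub_ofReal_pow μ (k + 1) hz).deriv]
      exact inv_mul_cancel_left₀ (hk k) _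

lemma im_inv_mul_I_sub_ofReal (x y : ℝ) :
    ((y * Complex.I - (x : ℂ))⁻¹).im = -y / (x ^ 2 + y ^ 2) := by
  simp [Complex.inv_im, Complex.normSq_apply, pow_two]

lemma integrable_sq_div_sq_add_sq (μ : Measure ℝ) [IsFiniteMeasure μ] (y : ℝ) :
    Integrable (fun x : ℝ => x ^ 2 / (x ^ 2 + y ^ 2)) μ := by
  refine Integrable.of_bound (Measurable.aestronglyMeasurable (by fun_prop)) 1
    (Eventually.of_forall fun x => ?_)
  rw [Real.norm_of_nonneg (by positivity)]
  exact div_le_one_of_le₀ (by nlinarith [sq_nonneg y]) (by positivity)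

lemma one_add_mul_im_cauchyTransform (μ : Measure ℝ) [IsProbabilityMeasure μ] {y : ℝ}
    (hy : 0 < y) :
    1 + y * (cauchyTransform μ (y * Complex.I)).im = ∫ x : ℝ, x ^ 2 / (x ^ 2 + y ^ 2) ∂μ := by
  have hker : Integrable (fun x : ℝ => (y * Complex.I - (x : ℂ))⁻¹) μ :=
    integrable_inv_sub_ofReal μ (by simpa using hy)
  have him : (cauchyTransform μ (y * Complex.I)).im = ∫ x : ℝ, -y / (x ^ 2 + y ^ 2) ∂μ := by
    simp_rw [← im_inv_mul_I_sub_ofReal]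
    exact (integral_im hker).symm
  have hker_im : Integrable (fun x : ℝ => -y / (x ^ 2 + y ^ 2)) μ := by
    simp_rw [← im_inv_mul_I_sub_ofReal]
    exact hker.im
  have hone : (1 : ℝ) = ∫ _, (1 : ℝ) ∂μ := by simp
  rw [him, ← integral_const_mul, hone, ← integral_add (integrable_const _) (hker_im.const_mul y)]
  refine integral_congr_ae (Eventually.of_forall fun x => ?_)
  have : x ^ 2 + y ^ 2 ≠ 0 := by positivity
  simp only
  field_simp
  ring

lemma measureReal_norm_gt_le (μ : Measure ℝ) [IsProbabilityMeasure μ] {y : ℝ} (hy : 0 < y) :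
    μ.real {x | y < ‖x‖} ≤ 2 * (1 + y * (cauchyTransform μ (y * Complex.I)).im) := by
  have hmarkov := mul_meas_ge_le_integral_of_nonneg (μ := μ)
    (f := fun x : ℝ => x ^ 2 / (x ^ 2 + y ^ 2)) (Eventually.of_forall fun x => by positivity)
    (integrable_sq_div_sq_add_sq μ y) (1 / 2)
  have hsub : {x : ℝ | y < ‖x‖} ⊆ {x : ℝ | 1 / 2 ≤ x ^ 2 / (x ^ 2 + y ^ 2)} := by
    intro x hx
    have hx' : y < |x| := hx
    have hsq : y ^ 2 < x ^ 2 := by rw [← sq_abs x]; gcongr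
    simp only [mem_ofPred_eq]
    rw [div_le_div_iff₀ two_pos (by positivity)]
    linarith
  have hmono := measureReal_mono (μ := μ) hsub
  rw [one_add_mul_im_cauchyTransform μ hy]
  linarith

lemma tendsto_one_add_mul_im_cauchyTransform (μ : Measure ℝ) [IsProbabilityMeasure μ] :
    Tendsto (fun y : ℝ => 1 + y * (cauchyTransform μ (y * Complex.I)).im) atTop (𝓝 0) := by
  have hlim : Tendsto (fun y : ℝ => ∫ x : ℝ, x ^ 2 / (x ^ 2 + y ^ 2) ∂μ) atTop
      (𝓝 (∫ _, (0 : ℝ) ∂μ)) := by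
    refine tendsto_integral_filter_of_dominated_convergence (fun _ => 1)
      (Eventually.of_forall fun y => (integrable_sq_div_sq_add_sq μ y).aestronglyMeasurable)
      (Eventually.of_forall fun y => Eventually.of_forall fun x => ?_) (integrable_const _)
      (Eventually.of_forall fun x => ?_)
    · rw [Real.norm_of_nonneg (by positivity)]
      exact div_le_one_of_le₀ (by nlinarith [sq_nonneg y]) (by positivity)
    · exact tendsto_const_nhds.div_atTop
        (tendsto_atTop_add_const_left _ _ (tendsto_pow_atTop two_ne_zero))
  rw [integral_zero] at hlim
  refine hlim.congr' ?_
  filter_upwards [eventually_gt_atTop 0] with y hy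
  exact (one_add_mul_im_cauchyTransform μ hy).symm

lemma isTightMeasureSet_of_tendsto_cauchyTransform (μ : Measure ℝ) (μs : ℕ → Measure ℝ)
    [IsProbabilityMeasure μ] [∀ n, IsProbabilityMeasure (μs n)]
    (h : ∀ z : ℂ, 0 < z.im →
      Tendsto (fun n => cauchyTransform (μs n) z) atTop (𝓝 (cauchyTransform μ z))) :
    IsTightMeasureSet (range μs) := by
  refine isTightMeasureSet_range_of_tendsto_limsup_measure_norm_gt ?_
  have hupper : Tendsto (fun y : ℝ =>
      ENNReal.ofReal (2 * (1 + y * (cauchyTransform μ (y * Complex.I)).im))) atTop (𝓝 0) := by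
    simpa using ENNReal.tendsto_ofReal
      ((tendsto_one_add_mul_im_cauchyTransform μ).const_mul 2)
  refine tendsto_of_tendsto_of_tendsto_of_le_of_le' tendsto_const_nhds hupper
    (Eventually.of_forall fun _ => zero_le) ?_
  filter_upwards [eventually_gt_atTop 0] with y hy
  have hlim : Tendsto (fun n =>
      ENNReal.ofReal (2 * (1 + y * (cauchyTransform (μs n) (y * Complex.I)).im))) atTop
      (𝓝 (ENNReal.ofReal (2 * (1 + y * (cauchyTransform μ (y * Complex.I)).im)))) :=
    ENNReal.tendsto_ofReal (((((Complex.continuous_im.tendsto _).comp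
      (h (y * Complex.I) (by simpa using hy))).const_mul y).const_add 1).const_mul 2)
  rw [← hlim.limsup_eq]
  refine limsup_le_limsup (Eventually.of_forall fun n => ?_)
  exact (ofReal_measureReal (μ := μs n) (s := {x | y < ‖x‖})).symm.trans_le <|
    ENNReal.ofReal_le_ofReal (measureReal_norm_gt_le (μs n) hy)

/-- The bounded continuous functions whose integrals along `μs` converge to the integral
against `μ`. -/
def convergenceSubmodule (μ : Measure ℝ) (μs : ℕ → Measure ℝ)
    [IsFiniteMeasure μ] [∀ n, IsFiniteMeasure (μs n)] : Submodule ℂ (ℝ →ᵇ ℂ) where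
  carrier := {g | Tendsto (fun n => ∫ x, g x ∂(μs n)) atTop (𝓝 (∫ x, g x ∂μ))}
  zero_mem' := by simp
  add_mem' {f g} hf hg := by
    simp only [mem_ofPred_eq, BoundedContinuousFunction.coe_add, Pi.add_apply] at hf hg ⊢
    rw [integral_add (f.integrable μ) (g.integrable μ)]
    simp_rw [fun n => integral_add (f.integrable (μs n)) (g.integrable (μs n))]
    exact hf.add hg
  smul_mem' c g hg := by
    simp only [mem_ofPred_eq, BoundedContinuousFunction.coe_smul, integral_smul] at hg ⊢
    exact hg.const_smul c

lemma star_mem_convergenceSubmodule {μ : Measure ℝ} {μs : ℕ → Measure ℝ}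
    [IsFiniteMeasure μ] [∀ n, IsFiniteMeasure (μs n)] {g : ℝ →ᵇ ℂ}
    (hg : g ∈ convergenceSubmodule μ μs) : star g ∈ convergenceSubmodule μ μs := by
  have h : Tendsto (fun n => ∫ x, g x ∂(μs n)) atTop (𝓝 (∫ x, g x ∂μ)) := hg
  change Tendsto (fun n => ∫ x, (starRingEnd ℂ) (g x) ∂(μs n)) atTop
    (𝓝 (∫ x, (starRingEnd ℂ) (g x) ∂μ))
  simp_rw [integral_conj]
  exact (Complex.continuous_conj.tendsto _).comp h

lemma cauchyKernel_I_mul_star (hI : 0 < Complex.I.im) :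
    cauchyKernel Complex.I hI * star (cauchyKernel Complex.I hI)
      = (Complex.I / 2) • (cauchyKernel Complex.I hI - star (cauchyKernel Complex.I hI)) := by
  ext x
  have h₁ := sub_ofReal_ne_zero hI x
  have h₂ : -Complex.I - (x : ℂ) ≠ 0 := by
    intro h
    simpa using congrArg Complex.im h
  simp only [BoundedContinuousFunction.coe_mul, Pi.mul_apply, BoundedContinuousFunction.coe_star,
    Pi.star_apply, BoundedContinuousFunction.coe_smul, BoundedContinuousFunction.coe_sub,
    Pi.sub_apply, cauchyKernel_apply, RCLike.star_def, map_inv₀, map_sub, Complex.conj_I,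
    Complex.conj_ofReal, smul_eq_mul]
  field_simp
  linear_combination (2 : ℂ) * Complex.I_sq

lemma Submodule.pow_mul_pow_mem_of_mul_eq {R A : Type*} [CommRing R] [CommRing A] [Algebra R A]
    (M : Submodule R A) {a b : A} {c : R} (hab : a * b = c • (a - b))
    (ha : ∀ k, a ^ k ∈ M) (hb : ∀ k, b ^ k ∈ M) (m n : ℕ) : a ^ m * b ^ n ∈ M := by
  induction m generalizing n with
  | zero => simpa using hb n
  | succ m ihm =>
    induction n with
    | zero => simpa using ha (m + 1)
    | succ n ihn =>
      have h : a ^ (m + 1) * b ^ (n + 1)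
          = c • (a ^ (m + 1) * b ^ n - a ^ m * b ^ (n + 1)) := by
        calc a ^ (m + 1) * b ^ (n + 1) = (a ^ m * b ^ n) * (a * b) := by ring
          _ = c • (a ^ (m + 1) * b ^ n - a ^ m * b ^ (n + 1)) := by
            rw [hab, mul_smul_comm]; ring_nf
      rw [h]
      exact M.smul_mem _ (M.sub_mem ihn (ihm (n + 1)))

lemma tendsto_of_tendstoLocallyUniformlyOn_cauchyTransform (μ : ProbabilityMeasure ℝ)
    (μs : ℕ → ProbabilityMeasure ℝ)
    (h : TendstoLocallyUniformlyOn (fun n z => cauchyTransform (μs n) z)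
      (cauchyTransform μ) atTop {z : ℂ | 0 < z.im}) :
    Tendsto μs atTop (𝓝 μ) := by
  have hI : 0 < Complex.I.im := by simp
  set r := cauchyKernel Complex.I hI with hr
  set M := convergenceSubmodule (μ : Measure ℝ) (fun n => (μs n : Measure ℝ))
  have hpow : ∀ k, r ^ k ∈ M := by
    rintro (_ | k)
    · change Tendsto _ _ _
      simp
    · exact (tendstoLocallyUniformlyOn_integral_inv_sub_ofReal_pow h k).tendsto_at hI
  have hpow_star : ∀ k, star r ^ k ∈ M := fun k => by
    rw [← star_pow]
    exact star_mem_convergenceSubmodule (hpow k)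
  refine ProbabilityMeasure.tendsto_of_tight_of_separatesPoints ℂ
    (isTightMeasureSet_of_tendsto_cauchyTransform (μ : Measure ℝ) (fun n => (μs n : Measure ℝ))
      fun z hz => h.tendsto_at hz) (A := StarAlgebra.adjoin ℂ {r}) ?_ fun g hg => ?_
  · intro x y hxy
    refine ⟨r, ⟨r.toContinuousMap, ?_, rfl⟩, ?_⟩
    · exact ⟨r, StarAlgebra.subset_adjoin ℂ _ rfl, rfl⟩
    · simpa [hr] using hxy
  · have hg' : g ∈ Submodule.span ℂ (Submonoid.closure ({r, star r} : Set (ℝ →ᵇ ℂ)) :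
        Set (ℝ →ᵇ ℂ)) := by
      rw [← Algebra.adjoin_eq_span]
      have : g ∈ (StarAlgebra.adjoin ℂ {r}).toSubalgebra := hg
      rwa [StarAlgebra.adjoin_toSubalgebra, Set.star_singleton, Set.singleton_union] at this
    refine (Submodule.span_le (p := M)).2 (fun f hf => ?_) hg'
    obtain ⟨m, n, rfl⟩ := (Submonoid.mem_closure_pair _ _ _).1 hf
    exact M.pow_mul_pow_mem_of_mul_eq (cauchyKernel_I_mul_star hI) hpow hpow_star m n

/-- Weak convergence of probability measures on ℝ is equivalent to locally uniform
convergence of the Cauchy transforms on the upper half-plane. -/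
theorem weak_convergence_iff_cauchyTransform_convergence
    (μ : Measure ℝ) (μs : ℕ → Measure ℝ)
    [IsProbabilityMeasure μ] [∀ n, IsProbabilityMeasure (μs n)] :
    (∀ f : BoundedContinuousFunction ℝ ℝ,
        Tendsto (fun n => ∫ x, f x ∂(μs n)) atTop (nhds (∫ x, f x ∂μ)))
    ↔ TendstoLocallyUniformlyOn (fun n z => cauchyTransform (μs n) z)
        (cauchyTransform μ) atTop {z : ℂ | 0 < z.im} := by
  let P : ProbabilityMeasure ℝ := ⟨μ, inferInstance⟩
  let Ps : ℕ → ProbabilityMeasure ℝ := fun n => ⟨μs n, inferInstance⟩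
  refine (ProbabilityMeasure.tendsto_iff_forall_integral_tendsto (μ := P) (μs := Ps)).symm.trans
    ⟨fun h => ?_, tendsto_of_tendstoLocallyUniformlyOn_cauchyTransform P Ps⟩
  rw [ProbabilityMeasure.tendsto_iff_forall_integral_rclike_tendsto ℂ] at h
  exact tendstoLocallyUniformlyOn_cauchyTransform μ μs fun z hz => h (cauchyKernel z hz)
end
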